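/- Let α be a type-B composition of n and let ω_{o;α} be the sign-symmetric permutation given, for a ∈ [n] with α-region i, by ω_{o;α}(a) = a if α is join and i = 1, and ω_{o;α}(a) = −(p_i + p_{i−1} + 1 − a) otherwise (and extended to negative arguments by sign-symmetry). Then ω_{o;α} ∈ H_α, and Inv(π) ⊆ Inv(ω_{o;α}) for every π ∈ H_α; that is, ω_{o;α} is the greatest element of H_α in the weak order. -/

import Mathlib

namespace TypeB

/-- A sign-symmetric permutation of degree `n`: a bijection of `ℤ` with
`π(-i) = -π(i)` which fixes every integer of absolute value `> n`.
It restricts to a sign-symmetric permutation of `±[n]`. -/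
structure SignedPerm (n : ℕ) where
  perm : Equiv.Perm ℤ
  sign_symm : ∀ i : ℤ, perm (-i) = - perm i
  outside : ∀ i : ℤ, (n : ℤ) < |i| → perm i = i

/-- Symbols for type-B inversions: `neg i` is `[i]`, `pair i j` (with `i < j`)
is `(i,j)`, and `mixed i j` (with `i < j`) is `(−j, i)`. -/
inductive BInv (n : ℕ) : Type where
  | neg : ℕ → BInv n
  | pair : ℕ → ℕ → BInv n
  | mixed : ℕ → ℕ → BInv n
deriving DecidableEq

/-- `i⁺`: `i+1` if `i ≠ -1`, and `1` for `i = -1`. -/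
def iplus (i : ℤ) : ℤ := if i = -1 then 1 else i + 1

/-- The inversion set of a sign-symmetric permutation. -/
def Inv {n : ℕ} (π : SignedPerm n) : Set (BInv n) := fun t =>
  match t with
  | .neg i => 1 ≤ i ∧ i ≤ n ∧ π.perm (i : ℤ) < 0
  | .pair i j => 1 ≤ i ∧ i < j ∧ j ≤ n ∧ π.perm (j : ℤ) < π.perm (i : ℤ)
  | .mixed i j => 1 ≤ i ∧ i < j ∧ j ≤ n ∧ π.perm (i : ℤ) + π.perm (j : ℤ) < 0

/-- The cover-inversion set of a sign-symmetric permutation. -/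
def Cov {n : ℕ} (π : SignedPerm n) : Set (BInv n) := fun t =>
  match t with
  | .neg i => 1 ≤ i ∧ i ≤ n ∧ π.perm (i : ℤ) = -1
  | .pair i j => 1 ≤ i ∧ i < j ∧ j ≤ n ∧ π.perm (i : ℤ) = iplus (π.perm (j : ℤ))
  | .mixed i j => 1 ≤ i ∧ i < j ∧ j ≤ n ∧ π.perm (-(j : ℤ)) = iplus (π.perm (i : ℤ))

/-- The symbol `(−j, i)` in canonical form (it equals `(−i, j)`). -/
def mixedInv {n : ℕ} (i j : ℕ) : BInv n := .mixed (min i j) (max i j)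

/-- A type-B composition of `n`: positive parts summing to `n`,
together with a split/join label. -/
structure BComp (n : ℕ) where
  parts : List ℕ
  pos : ∀ a ∈ parts, 0 < a
  sum_eq : parts.sum = n
  isJoin : Bool

/-- The partial sum `p_i = α₁ + ⋯ + α_i`. -/
def pSum {n : ℕ} (α : BComp n) (i : ℕ) : ℕ := (α.parts.take i).sum

/-- The α-region of `a ∈ [n]`: the unique `i` with `p_{i-1} < a ≤ p_i`. -/
def region {n : ℕ} (α : BComp n) (a : ℕ) : ℕ :=
  ((Finset.range α.parts.length).filter (fun j => pSum α j < a)).card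

/-- The first part `α₁` of a type-B composition. -/
def alpha1 {n : ℕ} (α : BComp n) : ℕ := α.parts.headI

/-- Index of the block of `Part(α)` containing `x ∈ ±[n]`; two elements lie in
a common block of `Part(α)` iff their indices agree. -/
def blockIdx {n : ℕ} (α : BComp n) (x : ℤ) : ℤ :=
  if 0 < x then
    (if α.isJoin = true ∧ region α x.toNat = 1 then 0 else (region α x.toNat : ℤ))
  else
    (if α.isJoin = true ∧ region α (-x).toNat = 1 then 0 else -(region α (-x).toNat : ℤ))

/-- Membership in `±[n]`. -/
def inPM (n : ℕ) (x : ℤ) : Prop := x ≠ 0 ∧ -(n : ℤ) ≤ x ∧ x ≤ (n : ℤ)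

/-- `π ∈ H_α`: `π` is increasing on every block of `Part(α)`. -/
def memH {n : ℕ} (α : BComp n) (π : SignedPerm n) : Prop :=
  ∀ a b : ℤ, inPM n a → inPM n b → a < b → blockIdx α a = blockIdx α b →
    π.perm a < π.perm b

/-- Common part of the type-B `(α,231)`- and `(α,312)`-patterns: indices
`i < j < k` in `±[n]`, in pairwise distinct blocks of `Part(α)`, with `j > 0`
and `π(i) = π(k)⁺`. -/
def patternCore {n : ℕ} (α : BComp n) (π : SignedPerm n) (i j k : ℤ) : Prop :=
  inPM n i ∧ inPM n j ∧ inPM n k ∧ i < j ∧ j < k ∧ 0 < j ∧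
  blockIdx α i ≠ blockIdx α j ∧ blockIdx α j ≠ blockIdx α k ∧
  blockIdx α i ≠ blockIdx α k ∧ π.perm i = iplus (π.perm k)

/-- `π` has a type-B `(α,231)`-split (resp. -join) pattern, according to the
label of `α`. -/
def has231 {n : ℕ} (α : BComp n) (π : SignedPerm n) : Prop :=
  ∃ i j k : ℤ, patternCore α π i j k ∧
    (if α.isJoin = true then
       (((alpha1 α : ℤ) < j → π.perm i < π.perm j) ∧
        (j ≤ (alpha1 α : ℤ) → π.perm j < π.perm k))
     else π.perm i < π.perm j)

/-- `π` has a type-B `(α,312)`-split (resp. -join) pattern, according to the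
label of `α`. -/
def has312 {n : ℕ} (α : BComp n) (π : SignedPerm n) : Prop :=
  ∃ i j k : ℤ, patternCore α π i j k ∧
    (if α.isJoin = true then
       (((alpha1 α : ℤ) < j → π.perm j < π.perm k) ∧
        (j ≤ (alpha1 α : ℤ) → π.perm i < π.perm j))
     else π.perm j < π.perm k)

/-- `π ∈ H_α(231)`. -/
def mem231 {n : ℕ} (α : BComp n) (π : SignedPerm n) : Prop := memH α π ∧ ¬ has231 α π

/-- `π ∈ H_α(312)`. -/
def mem312 {n : ℕ} (α : BComp n) (π : SignedPerm n) : Prop := memH α π ∧ ¬ has312 α π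

/-- The set `H_α`. -/
def Hset {n : ℕ} (α : BComp n) : Set (SignedPerm n) := {π | memH α π}

/-- The carrier of `Tam_B(α)`, namely `H_α(231)`. -/
def Tset {n : ℕ} (α : BComp n) : Set (SignedPerm n) := {π | mem231 α π}

/-- The weak order: inclusion of inversion sets. -/
def wle {n : ℕ} (π σ : SignedPerm n) : Prop := Inv π ⊆ Inv σ

/-- `m` is the greatest lower bound of `x` and `y` within `P`, w.r.t. the weak order. -/
def isMeetIn {n : ℕ} (P : Set (SignedPerm n)) (x y m : SignedPerm n) : Prop :=
  m ∈ P ∧ wle m x ∧ wle m y ∧ ∀ z ∈ P, wle z x → wle z y → wle z m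

/-- `u` is the least upper bound of `x` and `y` within `P`, w.r.t. the weak order. -/
def isJoinIn {n : ℕ} (P : Set (SignedPerm n)) (x y u : SignedPerm n) : Prop :=
  u ∈ P ∧ wle x u ∧ wle y u ∧ ∀ z ∈ P, wle x z → wle y z → wle u z

/-- `d = Π↓(π)`: `d` is the greatest element of `{σ ∈ H_α(231) : Inv σ ⊆ Inv π}`. -/
def isProjDown {n : ℕ} (α : BComp n) (π d : SignedPerm n) : Prop :=
  mem231 α d ∧ wle d π ∧ ∀ σ, mem231 α σ → wle σ π → wle σ d

/-- `d = Π†(π)`: `d` is the greatest element of `{σ ∈ H_α(312) : Inv σ ⊆ Inv π}`. -/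
def isProjDagger {n : ℕ} (α : BComp n) (π d : SignedPerm n) : Prop :=
  mem312 α d ∧ wle d π ∧ ∀ σ, mem312 α σ → wle σ π → wle σ d

/-- The value `ω_{o;α}(a)` for `a ∈ [n]`. -/
def omegaPos {n : ℕ} (α : BComp n) (a : ℕ) : ℤ :=
  if α.isJoin = true ∧ region α a = 1 then (a : ℤ)
  else -(((pSum α (region α a) : ℤ) + (pSum α (region α a - 1) : ℤ) + 1) - (a : ℤ))

/-- The longest element `ω_{o;α}` of `H_α`, as a function on `ℤ`. -/
def omegaFun {n : ℕ} (α : BComp n) (x : ℤ) : ℤ :=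
  if 0 < x ∧ x ≤ (n : ℤ) then omegaPos α x.toNat
  else if 0 < -x ∧ -x ≤ (n : ℤ) then -(omegaPos α (-x).toNat)
  else x

/-- The set of `m` such that there is a strict chain `x₀ < x₁ < ⋯ < x_m` in `P`. -/
def chainLengths {n : ℕ} (P : Set (SignedPerm n)) : Set ℕ :=
  {m | ∃ f : Fin (m + 1) → SignedPerm n, (∀ i, f i ∈ P) ∧
        ∀ i j : Fin (m + 1), i < j → Inv (f i) ⊂ Inv (f j)}

/-- `x` is join-irreducible in `Tam_B(α)`. -/
def joinIrred {n : ℕ} (α : BComp n) (x : SignedPerm n) : Prop :=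
  x ∈ Tset α ∧ ¬ (∀ y ∈ Tset α, wle x y) ∧
  ∀ y z, y ∈ Tset α → z ∈ Tset α → isJoinIn (Tset α) y z x → x = y ∨ x = z

/-- `x` is meet-irreducible in `Tam_B(α)`. -/
def meetIrred {n : ℕ} (α : BComp n) (x : SignedPerm n) : Prop :=
  x ∈ Tset α ∧ ¬ (∀ y ∈ Tset α, wle y x) ∧
  ∀ y z, y ∈ Tset α → z ∈ Tset α → isMeetIn (Tset α) y z x → x = y ∨ x = z

/-- `x` is left modular in the lattice on `P`: `(r ∨ x) ∧ q = r ∨ (x ∧ q)`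
for all `r ≤ q` in `P`. -/
def leftModular {n : ℕ} (P : Set (SignedPerm n)) (x : SignedPerm n) : Prop :=
  ∀ r q, r ∈ P → q ∈ P → wle r q →
    ∀ u v w1 w2, isJoinIn P r x u → isMeetIn P u q v →
      isMeetIn P x q w1 → isJoinIn P r w1 w2 → v = w2

/-- The simple generator `s_i` as a function on `ℤ`: `s₀` exchanges `1` and `-1`,
and for `i ≥ 1`, `s_i` exchanges `i` with `i+1` and `-i` with `-(i+1)`. -/
def sfun (i : ℕ) (x : ℤ) : ℤ :=
  if i = 0 then (if x = 1 then -1 else if x = -1 then 1 else x)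
  else if x = (i : ℤ) then (i : ℤ) + 1
  else if x = (i : ℤ) + 1 then (i : ℤ)
  else if x = -(i : ℤ) then -(i : ℤ) - 1
  else if x = -(i : ℤ) - 1 then -(i : ℤ)
  else x

/-- `i` is one of the partial sums `p₁, …, p_{r−1}` of `α`. -/
def isPSum {n : ℕ} (α : BComp n) (i : ℕ) : Prop :=
  ∃ j : ℕ, 1 ≤ j ∧ j < α.parts.length ∧ pSum α j = i

/-- `n² − Σᵢ α_i(α_i−1)/2`, minus additionally `(α₁+1)α₁/2` when `α` is join. -/
def lengthFormula {n : ℕ} (α : BComp n) : ℕ :=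
  n ^ 2 - (α.parts.map (fun a => a * (a - 1) / 2)).sum -
    (if α.isJoin = true then (alpha1 α + 1) * alpha1 α / 2 else 0)

theorem pSum_mono {n : ℕ} (α : BComp n) : Monotone (pSum α) := fun _ _ h =>
  ((List.take_sublist_take_left h).sum_le_sum fun _ _ => Nat.zero_le _)

theorem pSum_length {n : ℕ} (α : BComp n) : pSum α α.parts.length = n := by
  simp [pSum, α.sum_eq]

theorem region_mono {n : ℕ} (α : BComp n) : Monotone (region α) := fun _ _ h =>
  Finset.card_le_card <| Finset.monotone_filter_right _ fun _ _ hj => lt_of_lt_of_le hj h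

/-- The region of `a` is the least `i` with `a ≤ p_i`. -/
theorem region_eq_find {n : ℕ} (α : BComp n) {a : ℕ} (h : ∃ j, a ≤ pSum α j)
    (hn : a ≤ n) : region α a = Nat.find h := by
  have hset : (Finset.range α.parts.length).filter (fun j => pSum α j < a)
      = Finset.range (Nat.find h) := by
    ext j
    simp only [Finset.mem_filter, Finset.mem_range, Nat.lt_find_iff, not_le]
    constructor
    · rintro ⟨-, hj⟩ m hm
      exact (pSum_mono α hm).trans_lt hj
    · intro hj
      refine ⟨?_, hj j le_rfl⟩
      by_contra! hlen
      have := hj _ hlen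
      rw [pSum_length] at this
      omega
  rw [region, hset, Finset.card_range]

theorem region_spec {n : ℕ} (α : BComp n) {a : ℕ} (ha : 1 ≤ a) (hn : a ≤ n) :
    1 ≤ region α a ∧ pSum α (region α a - 1) < a ∧ a ≤ pSum α (region α a) := by
  have h : ∃ j, a ≤ pSum α j := ⟨_, hn.trans (pSum_length α).ge⟩
  rw [region_eq_find α h hn]
  have hpos : 1 ≤ Nat.find h := by
    rw [Nat.one_le_iff_ne_zero, ne_eq, Nat.find_eq_zero]
    simp [pSum]
    omega
  exact ⟨hpos, not_le.mp (Nat.find_min h (by omega)), Nat.find_spec h⟩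

theorem pSum_region_le {n : ℕ} (α : BComp n) {a b : ℕ} (h : region α a < region α b) :
    pSum α (region α a) ≤ pSum α (region α b - 1) :=
  pSum_mono α (by omega)

theorem blockIdx_natCast {n : ℕ} (α : BComp n) {a : ℕ} (ha : 1 ≤ a) :
    blockIdx α a = if α.isJoin = true ∧ region α a = 1 then 0 else (region α a : ℤ) := by
  simp [blockIdx, show 0 < a by omega]

theorem blockIdx_neg_natCast {n : ℕ} (α : BComp n) {a : ℕ} :
    blockIdx α (-(a : ℤ)) =
      if α.isJoin = true ∧ region α a = 1 then 0 else -(region α a : ℤ) := by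
  simp [blockIdx]

theorem omegaFun_natCast {n : ℕ} (α : BComp n) {a : ℕ} (ha : 1 ≤ a) (hn : a ≤ n) :
    omegaFun α a = omegaPos α a := by
  simp [omegaFun, hn, show 0 < a by omega]

theorem memH.perm_add_pos {n : ℕ} {α : BComp n} {π : SignedPerm n}
    (hπ : memH α π) {a b : ℕ} (ha : 1 ≤ a) (han : a ≤ n) (hb : 1 ≤ b) (hbn : b ≤ n)
    (hJ : α.isJoin = true) (hra : region α a = 1) (hrb : region α b = 1) :
    0 < π.perm a + π.perm b := by
  have h := hπ (-(a : ℤ)) b (by unfold inPM; omega) (by unfold inPM; omega) (by omega)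
    (by rw [blockIdx_neg_natCast, blockIdx_natCast α hb]; simp [hJ, hra, hrb])
  rw [π.sign_symm] at h
  omega

/-- `ω_{o;α}` is increasing on pairs of positive integers in a common region. -/
theorem omegaPos_lt_of_region_eq {n : ℕ} (α : BComp n) {a b : ℕ} (hab : a < b)
    (h : region α a = region α b) : omegaPos α a < omegaPos α b := by
  unfold omegaPos
  rw [h]
  split_ifs <;> omega

/-- `ω_{o;α}` is decreasing across regions. -/
theorem omegaPos_lt_of_region_lt {n : ℕ} (α : BComp n) {a b : ℕ} (ha : 1 ≤ a) (han : a ≤ n)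
    (hb : 1 ≤ b) (hbn : b ≤ n) (h : region α a < region α b) :
    omegaPos α b < omegaPos α a ∧ omegaPos α a + omegaPos α b < 0 := by
  obtain ⟨ha₁, ha₂, ha₃⟩ := region_spec α ha han
  obtain ⟨hb₁, hb₂, hb₃⟩ := region_spec α hb hbn
  have := pSum_region_le α h
  unfold omegaPos
  split_ifs <;> omega

theorem omegaPos_neg {n : ℕ} (α : BComp n) {a : ℕ} (ha : 1 ≤ a) (han : a ≤ n)
    (h : ¬(α.isJoin = true ∧ region α a = 1)) : omegaPos α a < 0 := by
  obtain ⟨-, ha₂, ha₃⟩ := region_spec α ha han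
  rw [omegaPos, if_neg h]
  omega

theorem region_eq_of_blockIdx_eq {n : ℕ} (α : BComp n) {a b : ℕ} (ha : 1 ≤ a) (han : a ≤ n)
    (hb : 1 ≤ b) (hbn : b ≤ n) (h : blockIdx α a = blockIdx α b) :
    region α a = region α b := by
  have := (region_spec α ha han).1
  have := (region_spec α hb hbn).1
  rw [blockIdx_natCast α ha, blockIdx_natCast α hb] at h
  split_ifs at h <;> omega

theorem blockIdx_neg {n : ℕ} (α : BComp n) {a : ℕ} (ha : 1 ≤ a) :
    blockIdx α (-(a : ℤ)) = -blockIdx α a := by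
  rw [blockIdx_neg_natCast, blockIdx_natCast α ha]
  split_ifs <;> simp

theorem memH_of_perm_eq_omegaFun {n : ℕ} (α : BComp n) (w : SignedPerm n)
    (hw : ∀ x : ℤ, w.perm x = omegaFun α x) : memH α w := by
  have hpos : ∀ a b : ℕ, 1 ≤ a → b ≤ n → a < b → blockIdx α a = blockIdx α b →
      w.perm a < w.perm b := by
    intro a b ha hb hab h
    rw [hw, hw, omegaFun_natCast α ha (by omega), omegaFun_natCast α (by omega) hb]
    exact omegaPos_lt_of_region_eq α hab
      (region_eq_of_blockIdx_eq α ha (by omega) (by omega) hb h)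
  rintro x y ⟨hx₀, hx₁, hx₂⟩ ⟨hy₀, hy₁, hy₂⟩ hxy h
  rcases lt_or_gt_of_ne hx₀ with hx | hx
  · obtain ⟨a, rfl⟩ : ∃ a : ℕ, x = -(a : ℤ) := ⟨(-x).toNat, by omega⟩
    rcases lt_or_gt_of_ne hy₀ with hy | hy
    · obtain ⟨b, rfl⟩ : ∃ b : ℕ, y = -(b : ℤ) := ⟨(-y).toNat, by omega⟩
      rw [blockIdx_neg α (by omega), blockIdx_neg α (by omega)] at h
      rw [w.sign_symm, w.sign_symm]
      exact neg_lt_neg (hpos b a (by omega) (by omega) (by omega) (neg_inj.mp h).symm)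
    · lift y to ℕ using hy.le with b
      have ha : 1 ≤ a := by omega
      have hb : 1 ≤ b := by omega
      have := (region_spec α ha (by omega)).1
      have := (region_spec α hb (by omega)).1
      rw [w.sign_symm, hw, hw, omegaFun_natCast α ha (by omega),
        omegaFun_natCast α hb (by omega)]
      rw [blockIdx_neg_natCast, blockIdx_natCast α hb] at h
      unfold omegaPos
      split_ifs at h ⊢ <;> omega
  · lift x to ℕ using hx.le with a
    lift y to ℕ using (hx.trans hxy).le with b
    exact hpos a b (by omega) (by omega) (by omega) h

theorem Inv_subset_of_perm_eq_omegaFun {n : ℕ} (α : BComp n) (w : SignedPerm n)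
    (hw : ∀ x : ℤ, w.perm x = omegaFun α x) (π : SignedPerm n) (hπ : memH α π) :
    Inv π ⊆ Inv w := by
  rintro (i | ⟨i, j⟩ | ⟨i, j⟩)
  · rintro ⟨hi, hin, h⟩
    refine ⟨hi, hin, ?_⟩
    rw [hw, omegaFun_natCast α hi hin]
    refine omegaPos_neg α hi hin fun ⟨hJ, hr⟩ => ?_
    have := hπ.perm_add_pos hi hin hi hin hJ hr hr
    omega
  · rintro ⟨hi, hij, hjn, h⟩
    refine ⟨hi, hij, hjn, ?_⟩
    rw [hw, hw, omegaFun_natCast α hi (by omega), omegaFun_natCast α (by omega) hjn]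
    refine (omegaPos_lt_of_region_lt α hi (by omega) (by omega) hjn
      ((region_mono α hij.le).lt_of_ne fun hr => h.not_gt ?_)).1
    refine hπ i j (by unfold inPM; omega) (by unfold inPM; omega) (by omega) ?_
    rw [blockIdx_natCast α hi, blockIdx_natCast α (by omega), hr]
  · rintro ⟨hi, hij, hjn, h⟩
    refine ⟨hi, hij, hjn, ?_⟩
    rw [hw, hw, omegaFun_natCast α hi (by omega), omegaFun_natCast α (by omega) hjn]
    rcases (region_mono α hij.le).lt_or_eq with hr | hr
    · exact (omegaPos_lt_of_region_lt α hi (by omega) (by omega) hjn hr).2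
    · have hJ : ¬(α.isJoin = true ∧ region α i = 1) := fun ⟨hJ, hri⟩ =>
        h.not_gt (hπ.perm_add_pos hi (by omega) (by omega) hjn hJ hri (hr ▸ hri))
      exact add_neg (omegaPos_neg α hi (by omega) hJ) (omegaPos_neg α (by omega) hjn (hr ▸ hJ))

/-- The permutation `ω_{o;α}` (given by the explicit formula
`omegaFun`) belongs to `H_α` and is its greatest element in the weak order:
`Inv(π) ⊆ Inv(ω_{o;α})` for every `π ∈ H_α`. -/
theorem omega_is_greatest_of_H (n : ℕ) (hn : 1 ≤ n) (α : BComp n)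
    (w : SignedPerm n) (hw : ∀ x : ℤ, w.perm x = omegaFun α x) :
    memH α w ∧ ∀ π : SignedPerm n, memH α π → Inv π ⊆ Inv w := by
  exact ⟨memH_of_perm_eq_omegaFun α w hw, Inv_subset_of_perm_eq_omegaFun α w hw⟩

end TypeB
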